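/- In the counterfactual model, assume X is exogenous relative to Y, Y is monotonic relative to X, 0 < P(X = 1) < 1 and P(X = 0, Y = 0) > 0. Then the probability of sufficient causation is identifiable and equals PS = (p_f − p_cf) / (1 − p_cf) = 1 − (1 − p_f)/(1 − p_cf). -/

import Mathlib

open MeasureTheory ProbabilityTheory

/-- Events determined by `U` factor against the events determined by an independent `V`. -/
lemma ProbabilityTheory.IndepFun.measureReal_inter_preimage_eq_mul
    {Ω α β : Type*} [MeasurableSpace Ω] [MeasurableSpace α] [MeasurableSpace β]
    {P : Measure Ω} {U : Ω → α} {V : Ω → β} (h : IndepFun U V P)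
    {s : Set α} {t : Set β} (hs : MeasurableSet s) (ht : MeasurableSet t) :
    P.real (V ⁻¹' t ∩ U ⁻¹' s) = P.real (V ⁻¹' t) * P.real (U ⁻¹' s) := by
  simp only [measureReal_def]
  rw [Set.inter_comm, h.measure_inter_preimage_eq_mul s t hs ht, ENNReal.toReal_mul, mul_comm]

/-- The elementary formula for a conditional probability, with real values. -/
lemma ProbabilityTheory.measureReal_cond_apply {Ω : Type*} [MeasurableSpace Ω] {P : Measure Ω}
    {s : Set Ω} (hs : MeasurableSet s) (t : Set Ω) :
    (P[|s]).real t = (P.real s)⁻¹ * P.real (s ∩ t) := by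
  simp only [measureReal_def, cond_apply hs, ENNReal.toReal_mul, ENNReal.toReal_inv]

/-- In the counterfactual model with binary cause `X`, potential responses `Y0, Y1`
and observed outcome `Y = Y_X` (consistency), if `X` is exogenous relative to `Y`,
`Y` is monotonic relative to `X`, `0 < P(X = 1) < 1` and `P(X = 0, Y = 0) > 0`,
then the probability of sufficient causation `PS = P(Y1 = 1 | X = 0, Y = 0)` is
identifiable and equals `(p_f − p_cf)/(1 − p_cf) = 1 − (1 − p_f)/(1 − p_cf)`,
where `p_f = P(Y = 1 | X = 1)` and `p_cf = P(Y = 1 | X = 0)`. -/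
theorem ps_identifiable
    {Ω : Type*} [MeasurableSpace Ω] (P : Measure Ω) [IsProbabilityMeasure P]
    (X Y0 Y1 Y : Ω → Bool)
    (hX : Measurable X) (hY0 : Measurable Y0) (hY1 : Measurable Y1)
    (hcons : ∀ ω, Y ω = if X ω = true then Y1 ω else Y0 ω)
    (hexo : IndepFun (fun ω => (Y0 ω, Y1 ω)) X P)
    (hmono : P {ω | Y1 ω = false ∧ Y0 ω = true} = 0)
    (hX0 : 0 < P {ω | X ω = true}) (hX1 : P {ω | X ω = true} < 1)
    (h00 : 0 < P {ω | X ω = false ∧ Y ω = false})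
    (pf pcf ps : ℝ)
    (hpf : pf = (P[{ω | Y ω = true} | {ω | X ω = true}]).toReal)
    (hpcf : pcf = (P[{ω | Y ω = true} | {ω | X ω = false}]).toReal)
    (hps : ps = (P[{ω | Y1 ω = true} | {ω | X ω = false ∧ Y ω = false}]).toReal) :
    ps = (pf - pcf) / (1 - pcf) ∧ ps = 1 - (1 - pf) / (1 - pcf) := by
  have hfac (x : Bool) (s : Set (Bool × Bool)) :
      P.real ({ω | X ω = x} ∩ {ω | (Y0 ω, Y1 ω) ∈ s}) =
        P.real {ω | X ω = x} * P.real {ω | (Y0 ω, Y1 ω) ∈ s} :=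
    hexo.measureReal_inter_preimage_eq_mul s.toFinite.measurableSet (measurableSet_singleton x)
  have hmX (x : Bool) : MeasurableSet {ω | X ω = x} := hX (measurableSet_singleton x)
  have hmY0 (x : Bool) : MeasurableSet {ω | Y0 ω = x} := hY0 (measurableSet_singleton x)
  have h00_eq : {ω | X ω = false ∧ Y ω = false} = {ω | X ω = false} ∩ {ω | Y0 ω = false} := by
    ext ω
    simp +contextual [hcons]
  have hX0_ne : P.real {ω | X ω = true} ≠ 0 :=
    (ENNReal.toReal_pos hX0.ne' (measure_ne_top _ _)).ne'
  have h00_ne : P.real {ω | X ω = false} * P.real {ω | Y0 ω = false} ≠ 0 := by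
    rw [h00_eq] at h00
    exact hfac false {y | y.1 = false} ▸ (ENNReal.toReal_pos h00.ne' (measure_ne_top _ _)).ne'
  have hX1_ne := left_ne_zero_of_mul h00_ne
  have hY0_ne := right_ne_zero_of_mul h00_ne
  have hpf' : pf = P.real {ω | Y1 ω = true} := by
    have hset : {ω | X ω = true} ∩ {ω | Y ω = true} =
        {ω | X ω = true} ∩ {ω | (Y0 ω, Y1 ω) ∈ {y : Bool × Bool | y.2 = true}} := by
      ext ω
      simp +contextual [hcons]
    rw [hpf, ← measureReal_def, measureReal_cond_apply (hmX true), hset, hfac,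
      inv_mul_cancel_left₀ hX0_ne]
    rfl
  have hpcf' : pcf = P.real {ω | Y0 ω = true} := by
    have hset : {ω | X ω = false} ∩ {ω | Y ω = true} =
        {ω | X ω = false} ∩ {ω | (Y0 ω, Y1 ω) ∈ {y : Bool × Bool | y.1 = true}} := by
      ext ω
      simp +contextual [hcons]
    rw [hpcf, ← measureReal_def, measureReal_cond_apply (hmX false), hset, hfac,
      inv_mul_cancel_left₀ hX1_ne]
    rfl
  have hps' : ps = P.real {ω | Y1 ω = true ∧ Y0 ω = false} / P.real {ω | Y0 ω = false} := by
    have hset : {ω | X ω = false} ∩ {ω | Y0 ω = false} ∩ {ω | Y1 ω = true} =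
        {ω | X ω = false} ∩
          {ω | (Y0 ω, Y1 ω) ∈ {y : Bool × Bool | y.2 = true ∧ y.1 = false}} := by
      ext ω
      simp [and_assoc, and_comm]
    rw [hps, ← measureReal_def, h00_eq, measureReal_cond_apply ((hmX false).inter (hmY0 false)),
      hset, hfac, show P.real ({ω | X ω = false} ∩ {ω | Y0 ω = false}) = _ from
        hfac false {y | y.1 = false}, inv_mul_eq_div, mul_div_mul_left _ _ hX1_ne]
    rfl
  have hcompl : P.real {ω | Y0 ω = false} = 1 - P.real {ω | Y0 ω = true} := by
    rw [← probReal_compl_eq_one_sub (hmY0 true)]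
    congr 1
    ext ω
    simp
  have hpns : P.real {ω | Y1 ω = true ∧ Y0 ω = false} =
      P.real {ω | Y1 ω = true} - P.real {ω | Y0 ω = true} := by
    have h1 : P.real {ω | Y1 ω = true} = P.real {ω | Y1 ω = true ∧ Y0 ω = true} +
        P.real {ω | Y1 ω = true ∧ Y0 ω = false} := by
      rw [← measureReal_inter_add_sdiff (s := {ω | Y1 ω = true}) (hmY0 true)]
      congr 2
      ext ω
      simp
    have h0 : P.real {ω | Y0 ω = true} = P.real {ω | Y1 ω = true ∧ Y0 ω = true} := by
      rw [← measureReal_inter_add_sdiff (s := {ω | Y0 ω = true})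
        (hY1 (measurableSet_singleton true))]
      have hdiff : {ω | Y0 ω = true} \ Y1 ⁻¹' {true} = {ω | Y1 ω = false ∧ Y0 ω = true} := by
        ext ω
        simp [and_comm]
      rw [hdiff, measureReal_def _ {ω | Y1 ω = false ∧ Y0 ω = true}, hmono,
        ENNReal.toReal_zero, add_zero, Set.inter_comm]
      rfl
    linarith
  have hden : 1 - pcf ≠ 0 := by rwa [hpcf', ← hcompl]
  have hmain : ps = (pf - pcf) / (1 - pcf) := by rw [hps', hpns, hcompl, hpf', hpcf']
  refine ⟨hmain, ?_⟩
  rw [hmain]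
  field_simp
  ring
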